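/- arXiv:1703.00188 — 6 statements merged into one kernel-verified Lean document; each statement's English description precedes it below -/
import Mathlib

section
/- Let {P_θ : θ ∈ ℝ} be a family of probability measures on an observation space Ω, let θ, θ̃ ∈ ℝ be such that P_θ̃ ≪ P_θ and D(P_θ̃‖P_θ) < ∞, and let θ̂ : Ω → ℝ be a measurable estimator that is square-integrable under P_θ̃ and unbiased at θ̃, i.e., E_θ̃[θ̂] = θ̃. Let α > 0 and let L be any real number with L ≤ E_θ̃[(θ̂ − θ̃)²]. Then ln E_θ[exp(α(θ̂ − θ)²)] ≥ α·L + α(θ̃ − θ)² − D(P_θ̃‖P_θ), where the left-hand side is allowed to be +∞. -/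
open MeasureTheory

/-- The Jensen inequality for the exponential, without integrability of `exp ∘ g`. -/
lemma ofReal_exp_integral_le_lintegral {Ω : Type*} [MeasurableSpace Ω]
    (μ : Measure Ω) [IsProbabilityMeasure μ] {g : Ω → ℝ} (hg : Integrable g μ) :
    ENNReal.ofReal (Real.exp (∫ x, g x ∂μ)) ≤ ∫⁻ x, ENNReal.ofReal (Real.exp (g x)) ∂μ := by
  by_cases hint : Integrable (fun x => Real.exp (g x)) μ
  · rw [← ofReal_integral_eq_lintegral_ofReal hint (ae_of_all _ fun x => (Real.exp_pos _).le)]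
    exact ENNReal.ofReal_le_ofReal (convexOn_exp.map_integral_le Real.continuous_exp.continuousOn
      isClosed_univ (ae_of_all _ fun _ => Set.mem_univ _) hg hint)
  · have htop : ∫⁻ x, ENNReal.ofReal (Real.exp (g x)) ∂μ = ⊤ := by
      by_contra h
      exact hint ((lintegral_ofReal_ne_top_iff_integrable
        (Real.continuous_exp.comp_aestronglyMeasurable hg.1)
        (ae_of_all _ fun x => (Real.exp_pos _).le)).1 h)
    simp [htop]

/-- The Donsker–Varadhan inequality for an integrable function. -/
lemma ofReal_exp_integral_sub_integral_llr_le_lintegral {Ω : Type*} [MeasurableSpace Ω]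
    (μ ν : Measure Ω) [IsProbabilityMeasure μ] [SigmaFinite ν] (hμν : μ ≪ ν)
    (hllr : Integrable (llr μ ν) μ) {f : Ω → ℝ} (hf : Measurable f) (hfi : Integrable f μ) :
    ENNReal.ofReal (Real.exp (∫ x, f x ∂μ - ∫ x, llr μ ν x ∂μ)) ≤
      ∫⁻ x, ENNReal.ofReal (Real.exp (f x)) ∂ν := by
  rw [← integral_sub hfi hllr]
  refine (ofReal_exp_integral_le_lintegral μ (hfi.sub hllr)).trans ?_
  have hmeas : Measurable fun x => ENNReal.ofReal (Real.exp (f x - llr μ ν x)) :=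
    (hf.sub (measurable_llr μ ν)).exp.ennreal_ofReal
  simp only [Pi.sub_apply]
  rw [← lintegral_rnDeriv_mul hμν hmeas.aemeasurable]
  refine lintegral_mono_ae ?_
  filter_upwards [μ.rnDeriv_lt_top ν] with x hx
  rcases eq_or_ne (μ.rnDeriv ν x) 0 with h0 | h0
  · simp [h0]
  · have hpos := ENNReal.toReal_pos h0 hx.ne
    rw [← ENNReal.ofReal_toReal hx.ne, ← ENNReal.ofReal_mul hpos.le, llr, Real.exp_sub,
      Real.exp_log hpos, mul_div_cancel₀ _ (ne_of_gt hpos)]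

/-- Part 2 of Theorem 1 (non-Bayesian regime): for an estimator unbiased at the
reference parameter `θ̃` and any lower bound `L` on the MSE at `θ̃`,
`ln E_θ[exp(α(θ̂ − θ)²)] ≥ α·L + α(θ̃ − θ)² − D(P_θ̃‖P_θ)`, the left-hand side
allowed to be `+∞` (stated in exponentiated form with a lower Lebesgue integral). -/
theorem stmt_2 {Ω : Type*} [MeasurableSpace Ω]
    (P : ℝ → Measure Ω) [∀ θ, IsProbabilityMeasure (P θ)]
    (θ θt : ℝ) (habs : P θt ≪ P θ)
    (hD : Integrable (fun x => Real.log (((P θt).rnDeriv (P θ) x).toReal)) (P θt))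
    (θhat : Ω → ℝ) (hmeas : Measurable θhat)
    (hsq : Integrable (fun x => (θhat x) ^ 2) (P θt))
    (hunb : ∫ x, θhat x ∂(P θt) = θt)
    (α : ℝ) (hα : 0 < α)
    (L : ℝ) (hL : L ≤ ∫ x, (θhat x - θt) ^ 2 ∂(P θt)) :
    ENNReal.ofReal
        (Real.exp (α * L + α * (θt - θ) ^ 2 -
          ∫ x, Real.log (((P θt).rnDeriv (P θ) x).toReal) ∂(P θt))) ≤
      ∫⁻ x, ENNReal.ofReal (Real.exp (α * (θhat x - θ) ^ 2)) ∂(P θ) := by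
  have hθi : Integrable θhat (P θt) :=
    ((memLp_two_iff_integrable_sq hmeas.aestronglyMeasurable).2 hsq).integrable one_le_two
  have hexpand (c : ℝ) :
      (fun x => (θhat x - c) ^ 2) = fun x => θhat x ^ 2 - 2 * c * θhat x + c ^ 2 := by
    ext x; ring
  have hint (c : ℝ) : Integrable (fun x => (θhat x - c) ^ 2) (P θt) := by
    rw [hexpand]
    exact (hsq.sub (hθi.const_mul _)).add (integrable_const _)
  have hval (c : ℝ) : ∫ x, (θhat x - c) ^ 2 ∂(P θt) =
      ∫ x, θhat x ^ 2 ∂(P θt) - 2 * c * θt + c ^ 2 := by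
    have hsub : Integrable (fun x => θhat x ^ 2 - 2 * c * θhat x) (P θt) :=
      hsq.sub (hθi.const_mul _)
    rw [hexpand, integral_add hsub (integrable_const _),
      integral_sub hsq (hθi.const_mul _), integral_const_mul, hunb]
    simp
  refine le_trans (ENNReal.ofReal_le_ofReal (Real.exp_le_exp.2 ?_))
    (ofReal_exp_integral_sub_integral_llr_le_lintegral (P θt) (P θ) habs hD
      (((hmeas.sub_const θ).pow_const 2).const_mul α) ((hint θ).const_mul α))
  rw [integral_const_mul, hval θ]
  rw [hval θt] at hL
  simp only [llr]
  nlinarith [mul_le_mul_of_nonneg_left hL hα.le]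
end

section
/- Let E_x > 0, T > 0, σ̃ > 0, and let ω be such that ∫₀ᵀ sin²(ωt) dt = T/2. Let Θ ~ N(0, σ̃²) and define g(t) = E[Θ·√(2E_x/T)·cos(ωt + Θ)] for t ∈ [0, T]. Then ∫₀ᵀ g(t)² dt = E_x·σ̃⁴·e^{−σ̃²}. -/
open MeasureTheory ProbabilityTheory

open scoped NNReal

lemma integrable_mul_cexp_mul_I_gaussianReal (v : ℝ≥0) :
    Integrable (fun x : ℝ => (x : ℂ) * Complex.exp (Complex.I * x)) (gaussianReal 0 v) := by
  have h : Integrable (fun x : ℝ => x) (gaussianReal 0 v) :=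
    (memLp_id_gaussianReal 1).integrable le_rfl
  refine h.mono (by fun_prop) (Filter.Eventually.of_forall fun x => ?_)
  simp [Complex.norm_exp]

lemma integral_mul_cexp_mul_I_gaussianReal (v : ℝ≥0) :
    ∫ x : ℝ, (x : ℂ) * Complex.exp (Complex.I * x) ∂(gaussianReal 0 v)
      = v * Complex.I * Complex.exp (-v / 2) := by
  have h := hasDerivAt_complexMGF (X := id) (μ := gaussianReal 0 v) (z := Complex.I)
    (by simp [integrableExpSet_id_gaussianReal])
  rw [funext complexMGF_id_gaussianReal] at h
  have h' : HasDerivAt (fun z : ℂ => Complex.exp (z * ((0 : ℝ) : ℂ) + v * z ^ 2 / 2))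
      (v * Complex.I * Complex.exp (-v / 2)) Complex.I := by
    have h2 : HasDerivAt (fun z : ℂ => z * ((0 : ℝ) : ℂ) + v * z ^ 2 / 2)
        (v * Complex.I) Complex.I := by
      have := ((hasDerivAt_id Complex.I).mul_const ((0 : ℝ) : ℂ)).add
        ((((hasDerivAt_id Complex.I).pow 2).const_mul (v : ℂ)).div_const 2)
      convert! this using 1
      simp
      ring
    convert! h2.cexp using 1
    simp
    ring
  exact h.unique h'

lemma integral_mul_cos_add_gaussianReal (v : ℝ≥0) (a : ℝ) :
    ∫ x, x * Real.cos (a + x) ∂(gaussianReal 0 v)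
      = -(v * Real.exp (-v / 2) * Real.sin a) := by
  have h : ∀ x : ℝ, x * Real.cos (a + x)
      = RCLike.re (Complex.exp (a * Complex.I) * ((x : ℂ) * Complex.exp (Complex.I * x))) := by
    intro x
    have : Complex.exp (a * Complex.I) * ((x : ℂ) * Complex.exp (Complex.I * x))
        = x * Complex.exp ((a + x : ℝ) * Complex.I) := by
      rw [mul_left_comm, ← Complex.exp_add]
      push_cast
      ring_nf
    rw [this, RCLike.re_eq_complex_re, Complex.re_ofReal_mul, Complex.exp_ofReal_mul_I_re]
  simp_rw [h]
  rw [integral_re ((integrable_mul_cexp_mul_I_gaussianReal v).const_mul _),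
    integral_const_mul, integral_mul_cexp_mul_I_gaussianReal]
  have : Complex.exp (a * Complex.I) * (v * Complex.I * Complex.exp (-v / 2))
      = ((v * Real.exp (-v / 2) : ℝ) : ℂ) * (Complex.I * Complex.exp (a * Complex.I)) := by
    push_cast
    ring
  rw [this, RCLike.re_eq_complex_re, Complex.re_ofReal_mul, Complex.I_mul_re,
    Complex.exp_ofReal_mul_I_im]
  ring

/-- Phase modulation: with `Θ ~ N(0, σ̃²)` and
`g(t) = E[Θ·√(2Eₓ/T)·cos(ωt + Θ)]`, if `∫₀ᵀ sin²(ωt) dt = T/2` then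
`∫₀ᵀ g(t)² dt = Eₓ·σ̃⁴·e^{−σ̃²}`. -/
theorem stmt_8 (Ex T σt ω : ℝ) (hEx : 0 < Ex) (hT : 0 < T) (hσt : 0 < σt)
    (hω : ∫ t in (0:ℝ)..T, Real.sin (ω * t) ^ 2 = T / 2) :
    let g : ℝ → ℝ := fun t =>
      ∫ x, x * (Real.sqrt (2 * Ex / T) * Real.cos (ω * t + x))
        ∂(gaussianReal 0 (Real.toNNReal (σt ^ 2)))
    ∫ t in (0:ℝ)..T, (g t) ^ 2 = Ex * σt ^ 4 * Real.exp (-σt ^ 2) := by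
  intro g
  have hexp : Real.exp (-σt ^ 2 / 2) ^ 2 = Real.exp (-σt ^ 2) := by
    rw [← Real.exp_nat_mul]
    congr 1
    push_cast
    ring
  have hsqrt : Real.sqrt (2 * Ex / T) ^ 2 = 2 * Ex / T := Real.sq_sqrt (by positivity)
  have hg : ∀ t, g t ^ 2
      = 2 * Ex / T * σt ^ 4 * Real.exp (-σt ^ 2) * Real.sin (ω * t) ^ 2 := by
    intro t
    simp only [g, mul_left_comm _ (Real.sqrt (2 * Ex / T))]
    rw [integral_const_mul, integral_mul_cos_add_gaussianReal,
      Real.coe_toNNReal _ (sq_nonneg σt), ← hexp, mul_pow, hsqrt]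
    ring
  simp_rw [hg]
  rw [intervalIntegral.integral_const_mul, hω]
  field_simp
end

section
/- Let P and Q be probability measures on a common measurable space with Q ≪ P, let a > 1, and let X be a real-valued measurable function. Assume R_a = ∫ (dQ/dP)^a dP < ∞ and that exp((a−1)X) is Q-integrable. Then ln ∫ exp(aX) dP ≥ (a/(a−1))·ln ∫ exp((a−1)X) dQ − (1/(a−1))·ln R_a, where the left-hand side is allowed to be +∞. -/
open MeasureTheory

/-- Hölder's inequality for the density of `Q` with respect to `P`. -/
theorem lintegral_le_lintegral_rnDeriv_rpow_mul_lintegral_rpow {Ω : Type*} [MeasurableSpace Ω]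
    {P Q : Measure Ω} [SigmaFinite P] [SigmaFinite Q] (hQP : Q ≪ P) {p q : ℝ}
    (hpq : p.HolderConjugate q) {f : Ω → ENNReal} (hf : AEMeasurable f P) :
    ∫⁻ x, f x ∂Q ≤
      (∫⁻ x, (Q.rnDeriv P x) ^ p ∂P) ^ (1 / p) * (∫⁻ x, f x ^ q ∂P) ^ (1 / q) := by
  rw [← lintegral_rnDeriv_mul hQP hf]
  exact ENNReal.lintegral_mul_le_Lp_mul_Lq P hpq (Measure.measurable_rnDeriv Q P).aemeasurable hf

/-- Logarithmic probability comparison bound (LPCB): for `Q ≪ P`, `a > 1`,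
`R_a = ∫ (dQ/dP)^a dP < ∞` and `exp((a−1)X)` Q-integrable,
`ln ∫ exp(aX) dP ≥ (a/(a−1))·ln ∫ exp((a−1)X) dQ − (1/(a−1))·ln R_a`,
the left-hand side allowed to be `+∞` (stated in exponentiated form). -/
theorem stmt_12 {Ω : Type*} [MeasurableSpace Ω]
    (P Q : Measure Ω) [IsProbabilityMeasure P] [IsProbabilityMeasure Q]
    (hQP : Q ≪ P) (a : ℝ) (ha : 1 < a)
    (hRa : ∫⁻ x, (Q.rnDeriv P x) ^ a ∂P ≠ ⊤)
    (X : Ω → ℝ) (hX : Measurable X)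
    (hint : Integrable (fun x => Real.exp ((a - 1) * X x)) Q) :
    ENNReal.ofReal
        (Real.exp ((a / (a - 1)) * Real.log (∫ x, Real.exp ((a - 1) * X x) ∂Q)
          - (1 / (a - 1)) * Real.log ((∫⁻ x, (Q.rnDeriv P x) ^ a ∂P).toReal)))
      ≤ ∫⁻ x, ENNReal.ofReal (Real.exp (a * X x)) ∂P := by
  set R := ∫⁻ x, (Q.rnDeriv P x) ^ a ∂P with hR
  set L := ∫⁻ x, ENNReal.ofReal (Real.exp (a * X x)) ∂P with hL
  set E := ∫ x, Real.exp ((a - 1) * X x) ∂Q with hE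
  rcases eq_or_ne L ⊤ with hLtop | hLtop
  · rw [hLtop]
    exact le_top
  have ha1 : 0 < a - 1 := sub_pos.2 ha
  have ha0 : 0 < a := one_pos.trans ha
  have hEpos : 0 < E := integral_exp_pos hint
  have holder : ENNReal.ofReal E ≤ R ^ (1 / a) * L ^ (1 / (a / (a - 1))) := by
    have hpow (x : Ω) : ENNReal.ofReal (Real.exp ((a - 1) * X x)) ^ (a / (a - 1)) =
        ENNReal.ofReal (Real.exp (a * X x)) := by
      rw [ENNReal.ofReal_rpow_of_pos (Real.exp_pos _), ← Real.exp_mul]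
      congr 2
      field_simp
    rw [hE, ofReal_integral_eq_lintegral_ofReal hint (ae_of_all _ fun x => (Real.exp_pos _).le)]
    refine (lintegral_le_lintegral_rnDeriv_rpow_mul_lintegral_rpow hQP
      (Real.HolderConjugate.conjExponent ha) (by fun_prop)).trans_eq ?_
    simp only [Real.conjExponent, hpow, hR, hL]
  have holder_real : E ≤ R.toReal ^ (1 / a) * L.toReal ^ (1 / (a / (a - 1))) := by
    rw [ENNReal.toReal_rpow, ENNReal.toReal_rpow, ← ENNReal.toReal_mul]
    refine (ENNReal.ofReal_le_iff_le_toReal (ENNReal.mul_ne_top ?_ ?_)).1 holder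
    · exact ENNReal.rpow_ne_top_of_nonneg (by positivity) hRa
    · exact ENNReal.rpow_ne_top_of_nonneg (by positivity) hLtop
  have hRpos : 0 < R.toReal := by
    refine ENNReal.toReal_nonneg.lt_of_ne' fun h => ?_
    rw [h, Real.zero_rpow (by positivity), zero_mul] at holder_real
    exact hEpos.not_ge holder_real
  have hLpos : 0 < L.toReal := by
    refine ENNReal.toReal_nonneg.lt_of_ne' fun h => ?_
    rw [h, Real.zero_rpow (by positivity), mul_zero] at holder_real
    exact hEpos.not_ge holder_real
  have hlog := Real.log_le_log hEpos holder_real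
  rw [Real.log_mul (by positivity) (by positivity), Real.log_rpow hRpos,
    Real.log_rpow hLpos] at hlog
  refine ENNReal.ofReal_le_of_le_toReal ?_
  rw [← Real.le_log_iff_exp_le hLpos, sub_le_iff_le_add]
  calc a / (a - 1) * Real.log E
      ≤ a / (a - 1) * (1 / a * Real.log R.toReal + 1 / (a / (a - 1)) * Real.log L.toReal) := by
        gcongr
    _ = Real.log L.toReal + 1 / (a - 1) * Real.log R.toReal := by
        field_simp
        ring
end

section
/- Let λ > 0, ω₀ ≠ 0, T > 0, E_x > 0, and set c = √(2E_x/(3T)), ν = λ/(λ + ω₀²). Define x(t) = c·(1 − cos(ω₀t)) and s(t) = c·(1 − ν·cos(ω₀t)). Then: (i) s(t) − s″(t)/λ = x(t) for all t; (ii) s′(0) = 0, and if sin(ω₀T) = 0 then also s′(T) = 0; (iii) if in addition ∫₀ᵀ cos²(ω₀t) dt = T/2 and ∫₀ᵀ sin²(ω₀t) dt = T/2, then ∫₀ᵀ (s(t) − x(t))² dt = (E_x/3)·(1 − ν)² and ∫₀ᵀ (s′(t))² dt = (E_x·ω₀²/3)·ν². -/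
theorem hasDerivAt_const_mul_one_sub_cos (c ν w t : ℝ) :
    HasDerivAt (fun t => c * (1 - ν * Real.cos (w * t))) (c * ν * w * Real.sin (w * t)) t := by
  have hlin : HasDerivAt (fun t : ℝ => w * t) w t := by
    simpa using (hasDerivAt_id t).const_mul w
  exact (((hlin.cos.const_mul ν).const_sub 1).const_mul c).congr_deriv (by ring)

theorem hasDerivAt_const_mul_sin (a w t : ℝ) :
    HasDerivAt (fun t => a * Real.sin (w * t)) (a * w * Real.cos (w * t)) t := by
  have hlin : HasDerivAt (fun t : ℝ => w * t) w t := by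
    simpa using (hasDerivAt_id t).const_mul w
  exact (hlin.sin.const_mul a).congr_deriv (by ring)

/-- Delay-estimation example: with `c = √(2Eₓ/(3T))`, `ν = λ/(λ + ω₀²)`,
`x(t) = c(1 − cos(ω₀t))` and `s(t) = c(1 − ν·cos(ω₀t))`:
(i) `s − s″/λ = x`; (ii) `s′(0) = 0`, and `s′(T) = 0` if `sin(ω₀T) = 0`;
(iii) if `∫₀ᵀ cos²(ω₀t) dt = T/2` and `∫₀ᵀ sin²(ω₀t) dt = T/2` then
`∫₀ᵀ (s − x)² = (Eₓ/3)(1 − ν)²` and `∫₀ᵀ (s′)² = (Eₓω₀²/3)ν²`. -/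
theorem stmt_14 (lam omega0 T Ex : ℝ) (hlam : 0 < lam) (homega : omega0 ≠ 0)
    (hT : 0 < T) (hEx : 0 < Ex) :
    let c : ℝ := Real.sqrt (2 * Ex / (3 * T))
    let ν : ℝ := lam / (lam + omega0 ^ 2)
    let x : ℝ → ℝ := fun t => c * (1 - Real.cos (omega0 * t))
    let s : ℝ → ℝ := fun t => c * (1 - ν * Real.cos (omega0 * t))
    (∀ t, s t - deriv (deriv s) t / lam = x t) ∧
    (deriv s 0 = 0) ∧
    (Real.sin (omega0 * T) = 0 → deriv s T = 0) ∧
    ((∫ t in (0:ℝ)..T, Real.cos (omega0 * t) ^ 2 = T / 2) →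
      (∫ t in (0:ℝ)..T, Real.sin (omega0 * t) ^ 2 = T / 2) →
      (∫ t in (0:ℝ)..T, (s t - x t) ^ 2) = (Ex / 3) * (1 - ν) ^ 2 ∧
      (∫ t in (0:ℝ)..T, (deriv s t) ^ 2) = (Ex * omega0 ^ 2 / 3) * ν ^ 2) := by
  intro c ν x s
  have hden : lam + omega0 ^ 2 ≠ 0 := by positivity
  have hc : c ^ 2 = 2 * Ex / (3 * T) := Real.sq_sqrt (by positivity)
  have hds : deriv s = fun t => c * ν * omega0 * Real.sin (omega0 * t) :=
    funext fun t => (hasDerivAt_const_mul_one_sub_cos c ν omega0 t).deriv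
  have hν : ν * (lam + omega0 ^ 2) = lam := div_mul_cancel₀ _ hden
  refine ⟨fun t => ?_, by simp [hds], fun h => by simp [hds, h], fun hcos hsin => ⟨?_, ?_⟩⟩
  · rw [hds, (hasDerivAt_const_mul_sin _ omega0 t).deriv]
    simp only [s, x]
    field_simp
    linear_combination (-c * Real.cos (omega0 * t)) * hν
  · have hsx : ∀ t, (s t - x t) ^ 2 = (c * (1 - ν)) ^ 2 * Real.cos (omega0 * t) ^ 2 :=
      fun t => by simp only [s, x]; ring
    simp only [hsx, intervalIntegral.integral_const_mul, hcos, mul_pow, hc]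
    field_simp
  · simp only [hds, mul_pow, intervalIntegral.integral_const_mul, hsin, hc]
    field_simp
end

section
/- For q ∈ [0, 1] and θ ∈ (0, 1), let D(q‖θ) = q·ln(q/θ) + (1−q)·ln((1−q)/(1−θ)) denote the binary divergence (with the convention 0·ln 0 = 0). For a ≥ 0, define E(a) = sup_{q ∈ [0,1]} inf_{t ∈ [0,1]} sup_{θ ∈ (0,1)} [a·(t − θ)² − D(q‖θ)]. Then E(a) ≥ 0 for every a ≥ 0, and E(a) = 0 for every a ∈ [0, 2]. -/
/-- Binary divergence `D(q‖θ) = q ln(q/θ) + (1−q) ln((1−q)/(1−θ))`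
(the convention `0·ln 0 = 0` holds automatically since `Real.log 0 = 0`). -/
noncomputable def Dbin (q θ : ℝ) : ℝ :=
  q * Real.log (q / θ) + (1 - q) * Real.log ((1 - q) / (1 - θ))

/-- The asymptotic exponent
`E(a) = sup_{q∈[0,1]} inf_{t∈[0,1]} sup_{θ∈(0,1)} [a(t − θ)² − D(q‖θ)]`. -/
noncomputable def Eexp (a : ℝ) : ℝ :=
  sSup ((fun q =>
    sInf ((fun t =>
      sSup ((fun θ => a * (t - θ) ^ 2 - Dbin q θ) '' Set.Ioo (0 : ℝ) 1))
      '' Set.Icc (0 : ℝ) 1)) '' Set.Icc (0 : ℝ) 1)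

theorem Dbin_eq {q θ : ℝ} (hθ : θ ∈ Set.Ioo (0 : ℝ) 1) :
    Dbin q θ = q * Real.log q + (1 - q) * Real.log (1 - q)
      - q * Real.log θ - (1 - q) * Real.log (1 - θ) := by
  have key : ∀ x y : ℝ, 0 < y →
      x * Real.log (x / y) = x * Real.log x - x * Real.log y := by
    intro x y hy
    rcases eq_or_ne x 0 with rfl | hx
    · simp
    · rw [Real.log_div hx hy.ne']; ring
  rw [Dbin, key q θ hθ.1, key (1 - q) (1 - θ) (sub_pos.2 hθ.2)]
  ring

theorem Dbin_one_sub (q θ : ℝ) : Dbin (1 - q) (1 - θ) = Dbin q θ := by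
  simp only [Dbin, sub_sub_cancel]
  ring

theorem two_mul_sq_le_Dbin_of_le {q θ : ℝ} (hq : 0 ≤ q) (hqθ : q ≤ θ)
    (hθ : θ ∈ Set.Ioo (0 : ℝ) 1) : 2 * (q - θ) ^ 2 ≤ Dbin q θ := by
  let f : ℝ → ℝ := fun x =>
    -(q * Real.log x) - (1 - q) * Real.log (1 - x) - 2 * (q - x) ^ 2
  have hcont_log : ContinuousOn (fun x => q * Real.log x) (Set.Icc q θ) := by
    rcases hq.eq_or_lt with rfl | hq
    · simpa using continuousOn_const
    · exact continuousOn_const.mul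
        (Real.continuousOn_log.mono fun x hx => (hq.trans_le hx.1).ne')
  have hcont : ContinuousOn f (Set.Icc q θ) := by
    refine (hcont_log.neg.sub (continuousOn_const.mul ?_)).sub (by fun_prop)
    exact ContinuousOn.log (by fun_prop) fun x hx => by linarith [hx.2, hθ.2]
  have hderiv : ∀ x ∈ Set.Ioo q θ,
      HasDerivAt f ((x - q) * (1 - 2 * x) ^ 2 / (x * (1 - x))) x := by
    intro x hx
    have hx0 : x ≠ 0 := (hq.trans_lt hx.1).ne'
    have hx1 : 1 - x ≠ 0 := by linarith [hx.2, hθ.2]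
    have h1 := ((Real.hasDerivAt_log hx0).const_mul q).neg
    have h2 := (((hasDerivAt_id x).const_sub 1).log hx1).const_mul (1 - q)
    have h3 := (((hasDerivAt_id x).const_sub q).pow 2).const_mul 2
    refine ((h1.sub h2).sub h3).congr_deriv ?_
    simp only [id]
    field_simp
    ring
  have hmono : MonotoneOn f (Set.Icc q θ) := by
    refine monotoneOn_of_deriv_nonneg (convex_Icc q θ) hcont ?_ ?_
    · rw [interior_Icc]
      exact fun x hx => (hderiv x hx).differentiableAt.differentiableWithinAt
    · rw [interior_Icc]
      intro x hx
      rw [(hderiv x hx).deriv]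
      have hx1 : 0 < 1 - x := by linarith [hx.2, hθ.2]
      have hx0 : 0 < x := hq.trans_lt hx.1
      have hxq : 0 < x - q := sub_pos.2 hx.1
      positivity
  have h := hmono (Set.left_mem_Icc.2 hqθ) (Set.right_mem_Icc.2 hqθ) hqθ
  simp only [f, sub_self] at h
  rw [Dbin_eq hθ]
  linarith

/-- Pinsker's inequality for Bernoulli distributions. -/
theorem two_mul_sq_le_Dbin {q θ : ℝ} (hq : q ∈ Set.Icc (0 : ℝ) 1)
    (hθ : θ ∈ Set.Ioo (0 : ℝ) 1) : 2 * (q - θ) ^ 2 ≤ Dbin q θ := by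
  rcases le_total q θ with h | h
  · exact two_mul_sq_le_Dbin_of_le hq.1 h hθ
  · have := two_mul_sq_le_Dbin_of_le (q := 1 - q) (θ := 1 - θ) (by linarith [hq.2])
      (by linarith) ⟨by linarith [hθ.2], by linarith [hθ.1]⟩
    rw [Dbin_one_sub] at this
    linarith [show (1 - q - (1 - θ)) ^ 2 = (q - θ) ^ 2 by ring]

theorem Dbin_self {q : ℝ} (hq : q ∈ Set.Ioo (0 : ℝ) 1) : Dbin q q = 0 := by
  rw [Dbin_eq hq]
  ring

theorem exists_Dbin_zero_eq {ε : ℝ} (hε : 0 < ε) :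
    ∃ θ ∈ Set.Ioo (0 : ℝ) 1, Dbin 0 θ = ε := by
  have h1 : Real.exp (-ε) < 1 := by simpa using hε
  refine ⟨1 - Real.exp (-ε), ⟨by linarith, by linarith [Real.exp_pos (-ε)]⟩, ?_⟩
  simp [Dbin]

theorem exists_Dbin_le {q ε : ℝ} (hq : q ∈ Set.Icc (0 : ℝ) 1) (hε : 0 < ε) :
    ∃ θ ∈ Set.Ioo (0 : ℝ) 1, Dbin q θ ≤ ε := by
  obtain ⟨θ, hθ, h⟩ := exists_Dbin_zero_eq hε
  rcases hq.1.eq_or_lt with rfl | h0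
  · exact ⟨θ, hθ, h.le⟩
  rcases hq.2.eq_or_lt with rfl | h1
  · refine ⟨1 - θ, ⟨by linarith [hθ.2], by linarith [hθ.1]⟩, ?_⟩
    rw [← Dbin_one_sub]
    simpa using h.le
  · exact ⟨q, ⟨h0, h1⟩, (Dbin_self ⟨h0, h1⟩).trans_le hε.le⟩

theorem bddAbove_image_sub_Dbin {a q t : ℝ} (ha : 0 ≤ a) (hq : q ∈ Set.Icc (0 : ℝ) 1)
    (ht : t ∈ Set.Icc (0 : ℝ) 1) :
    BddAbove ((fun θ => a * (t - θ) ^ 2 - Dbin q θ) '' Set.Ioo (0 : ℝ) 1) := by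
  refine ⟨a, ?_⟩
  rintro _ ⟨θ, hθ, rfl⟩
  have hD : 0 ≤ Dbin q θ := (by positivity : (0 : ℝ) ≤ 2 * (q - θ) ^ 2).trans
    (two_mul_sq_le_Dbin hq hθ)
  have hsq : (t - θ) ^ 2 ≤ 1 := by
    rw [sq_le_one_iff_abs_le_one, abs_le]
    constructor <;> linarith [ht.1, ht.2, hθ.1, hθ.2]
  linarith [mul_le_of_le_one_right ha hsq]

theorem sSup_image_sub_Dbin_nonneg {a q t : ℝ} (ha : 0 ≤ a) (hq : q ∈ Set.Icc (0 : ℝ) 1)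
    (ht : t ∈ Set.Icc (0 : ℝ) 1) :
    0 ≤ sSup ((fun θ => a * (t - θ) ^ 2 - Dbin q θ) '' Set.Ioo (0 : ℝ) 1) := by
  refine le_of_forall_pos_le_add fun ε hε => ?_
  obtain ⟨θ, hθ, hD⟩ := exists_Dbin_le hq hε
  have h := le_csSup (bddAbove_image_sub_Dbin ha hq ht) (Set.mem_image_of_mem _ hθ)
  have : 0 ≤ a * (t - θ) ^ 2 := by positivity
  linarith

theorem Eexp_nonneg {a : ℝ} (ha : 0 ≤ a) : 0 ≤ Eexp a := by
  refine Real.sSup_nonneg ?_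
  rintro _ ⟨q, hq, rfl⟩
  refine Real.sInf_nonneg ?_
  rintro _ ⟨t, ht, rfl⟩
  exact sSup_image_sub_Dbin_nonneg ha hq ht

theorem Eexp_nonpos {a : ℝ} (ha : a ∈ Set.Icc (0 : ℝ) 2) : Eexp a ≤ 0 := by
  refine Real.sSup_le ?_ le_rfl
  rintro _ ⟨q, hq, rfl⟩
  refine (csInf_le ⟨0, ?_⟩ (Set.mem_image_of_mem _ hq)).trans (Real.sSup_le ?_ le_rfl)
  · rintro _ ⟨t, ht, rfl⟩
    exact sSup_image_sub_Dbin_nonneg ha.1 hq ht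
  · rintro _ ⟨θ, hθ, rfl⟩
    linarith [two_mul_sq_le_Dbin hq hθ, mul_le_mul_of_nonneg_right ha.2 (sq_nonneg (q - θ))]

/-- `E(a) ≥ 0` for all `a ≥ 0`, and `E(a) = 0` for all `a ∈ [0, 2]`
(phase transition at `a = 2`). -/
theorem stmt_15 :
    (∀ a : ℝ, 0 ≤ a → 0 ≤ Eexp a) ∧ (∀ a ∈ Set.Icc (0 : ℝ) 2, Eexp a = 0) :=
  ⟨fun _ ha => Eexp_nonneg ha, fun _ ha => (Eexp_nonpos ha).antisymm (Eexp_nonneg ha.1)⟩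
end

section
/- Let n ≥ 1, let s ∈ ℝⁿ be nonzero, let v > 0, and for θ ∈ ℝ let P_θ be the Gaussian measure N(θ·s, v·Iₙ) on ℝⁿ. Let θ̂ : ℝⁿ → ℝ be a measurable estimator that is square-integrable and unbiased under every P_θ, i.e., E_θ[θ̂] = θ for all θ ∈ ℝ. Then for every α > ‖s‖²/(2v) and every θ ∈ ℝ, E_θ[exp(α(θ̂ − θ)²)] = +∞. -/
open MeasureTheory ProbabilityTheory

/-- A product of probability measures with densities has the product density. -/
lemma pi_withDensity_eq_withDensity_prod {ι : Type*} [Fintype ι] {X : ι → Type*}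
    [∀ i, MeasurableSpace (X i)] (μ : ∀ i, Measure (X i)) [∀ i, IsProbabilityMeasure (μ i)]
    {f : ∀ i, X i → ENNReal} (hf : ∀ i, Measurable (f i))
    [∀ i, SigmaFinite ((μ i).withDensity (f i))] :
    Measure.pi (fun i => (μ i).withDensity (f i)) =
      (Measure.pi μ).withDensity fun x => ∏ i, f i (x i) := by
  refine Measure.pi_eq fun t ht => ?_
  have hg : ∀ i, Measurable ((t i).indicator (f i)) := fun i => (hf i).indicator (ht i)
  have hind : (Set.univ.pi t).indicator (fun x : ∀ i, X i => ∏ i, f i (x i)) =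
      fun x => ∏ i, (t i).indicator (f i) (x i) := by
    ext x
    by_cases hx : x ∈ Set.univ.pi t
    · rw [Set.indicator_of_mem hx]
      exact Finset.prod_congr rfl fun i _ =>
        (Set.indicator_of_mem (hx i (Set.mem_univ i)) _).symm
    · rw [Set.indicator_of_notMem hx]
      obtain ⟨i, hi⟩ : ∃ i, x i ∉ t i := by simpa [Set.mem_pi] using hx
      exact (Finset.prod_eq_zero (Finset.mem_univ i) (Set.indicator_of_notMem hi _)).symm
  rw [withDensity_apply _ (MeasurableSet.univ_pi ht),
    ← lintegral_indicator (MeasurableSet.univ_pi ht), hind,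
    lintegral_prod_eq_prod_lintegral_of_indepFun Finset.univ _
      (iIndepFun_pi fun i => (hg i).aemeasurable)
      fun i => (hg i).comp (measurable_pi_apply i)]
  refine Finset.prod_congr rfl fun i _ => ?_
  rw [(measurePreserving_eval μ i).lintegral_comp (hg i), lintegral_indicator (ht i),
    withDensity_apply _ (ht i)]

/-- Cameron-Martin formula on the real line. -/
lemma gaussianReal_eq_withDensity_gaussianReal {v : ℝ} (hv : 0 < v) (m m' : ℝ) :
    gaussianReal m v.toNNReal = (gaussianReal m' v.toNNReal).withDensity fun x =>
      ENNReal.ofReal (Real.exp ((m - m') / v * (x - m') - (m - m') ^ 2 / (2 * v))) := by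
  have hv' : v.toNNReal ≠ 0 := (Real.toNNReal_pos.2 hv).ne'
  rw [gaussianReal_of_var_ne_zero m hv', gaussianReal_of_var_ne_zero m' hv',
    ← withDensity_mul _ (measurable_gaussianPDF _ _) (by fun_prop)]
  congr 1
  ext x
  rw [Pi.mul_apply, gaussianPDF, gaussianPDF, ← ENNReal.ofReal_mul (gaussianPDFReal_nonneg _ _ _),
    gaussianPDFReal, gaussianPDFReal, mul_assoc _ (Real.exp _), ← Real.exp_add, Real.coe_toNNReal v hv.le]
  congr 3
  field_simp
  ring

/-- Cameron-Martin formula for products of real Gaussian measures of equal variance. -/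
lemma pi_gaussianReal_eq_withDensity {ι : Type*} [Fintype ι] {v : ℝ} (hv : 0 < v) (m m' : ι → ℝ) :
    Measure.pi (fun i => gaussianReal (m i) v.toNNReal) =
      (Measure.pi fun i => gaussianReal (m' i) v.toNNReal).withDensity fun y =>
        ENNReal.ofReal (Real.exp
          (∑ i, ((m i - m' i) / v * (y i - m' i) - (m i - m' i) ^ 2 / (2 * v)))) := by
  have hσ : ∀ i, SigmaFinite ((gaussianReal (m' i) v.toNNReal).withDensity fun x =>
      ENNReal.ofReal (Real.exp ((m i - m' i) / v * (x - m' i) - (m i - m' i) ^ 2 / (2 * v)))) := by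
    intro i
    rw [← gaussianReal_eq_withDensity_gaussianReal hv]
    infer_instance
  simp_rw [Real.exp_sum, ENNReal.ofReal_prod_of_nonneg fun _ _ => (Real.exp_pos _).le]
  rw [← pi_withDensity_eq_withDensity_prod
    (f := fun i x => ENNReal.ofReal
      (Real.exp ((m i - m' i) / v * (x - m' i) - (m i - m' i) ^ 2 / (2 * v))))
    _ fun i => by fun_prop]
  exact congrArg Measure.pi (funext fun i => gaussianReal_eq_withDensity_gaussianReal hv _ _)

/-- Jensen's inequality for `exp`, with no integrability assumption on `exp ∘ g`. -/
lemma ofReal_exp_integral_le_lintegral_exp {Ω : Type*} [MeasurableSpace Ω] {μ : Measure Ω}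
    [IsProbabilityMeasure μ] {g : Ω → ℝ} (hg : Integrable g μ) :
    ENNReal.ofReal (Real.exp (∫ x, g x ∂μ)) ≤ ∫⁻ x, ENNReal.ofReal (Real.exp (g x)) ∂μ := by
  by_cases hi : Integrable (fun x => Real.exp (g x)) μ
  · rw [← ofReal_integral_eq_lintegral_ofReal hi (ae_of_all _ fun x => (Real.exp_pos _).le)]
    exact ENNReal.ofReal_le_ofReal (convexOn_exp.map_integral_le Real.continuous_exp.continuousOn
      isClosed_univ (by simp) hg hi)
  · have hm := Real.continuous_exp.comp_aestronglyMeasurable hg.1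
    refine le_top.trans_eq (Eq.symm (not_not.1 fun h => hi ⟨hm, ?_⟩))
    rw [hasFiniteIntegral_iff_ofReal (ae_of_all _ fun x => (Real.exp_pos _).le)]
    exact lt_top_iff_ne_top.2 h

/-- The exponential quadratic moment of an estimator around `c` under the mean vector `m` is
bounded below through its bias under `m'` and the relative entropy of the two Gaussian models. -/
lemma ofReal_exp_le_lintegral_exp_mul_sq {ι : Type*} [Fintype ι] {v : ℝ} (hv : 0 < v)
    (m m' : ι → ℝ) {T : (ι → ℝ) → ℝ} (hT : Measurable T)
    (hsq : Integrable (fun y => T y ^ 2) (Measure.pi fun i => gaussianReal (m' i) v.toNNReal))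
    {α : ℝ} (hα : 0 ≤ α) (c : ℝ) :
    ENNReal.ofReal (Real.exp
      (α * ((∫ y, T y ∂(Measure.pi fun i => gaussianReal (m' i) v.toNNReal)) - c) ^ 2
        - (∑ i, (m i - m' i) ^ 2) / (2 * v))) ≤
      ∫⁻ y, ENNReal.ofReal (Real.exp (α * (T y - c) ^ 2))
        ∂(Measure.pi fun i => gaussianReal (m i) v.toNNReal) := by
  rw [pi_gaussianReal_eq_withDensity hv m m',
    lintegral_withDensity_eq_lintegral_mul _ (by fun_prop) (by fun_prop)]
  set Q := Measure.pi fun i => gaussianReal (m' i) v.toNNReal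
  have hL2 : MemLp T 2 Q := (memLp_two_iff_integrable_sq hT.aestronglyMeasurable).2 hsq
  have hc2 : MemLp (fun y => T y - c) 2 Q := hL2.sub (memLp_const c)
  have hcoord : ∀ i, Integrable (fun y : ι → ℝ => y i) Q := fun i =>
    integrable_eval ((memLp_id_gaussianReal 1).integrable (by simp))
  have hlin : ∀ i, Integrable (fun y : ι → ℝ => (m i - m' i) / v * (y i - m' i)) Q := fun i =>
    ((hcoord i).sub (integrable_const _)).const_mul _
  have hterm : ∀ i, Integrable (fun y : ι → ℝ =>
      (m i - m' i) / v * (y i - m' i) - (m i - m' i) ^ 2 / (2 * v)) Q := fun i =>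
    (hlin i).sub (integrable_const _)
  have hllr := integrable_finsetSum Finset.univ fun i _ => hterm i
  have hint := hllr.add (hc2.integrable_sq.const_mul α)
  have hmean : ∫ y, ∑ i, ((m i - m' i) / v * (y i - m' i) - (m i - m' i) ^ 2 / (2 * v)) ∂Q =
      -((∑ i, (m i - m' i) ^ 2) / (2 * v)) := by
    rw [integral_finsetSum _ fun i _ => hterm i, Finset.sum_div, ← Finset.sum_neg_distrib]
    refine Finset.sum_congr rfl fun i _ => ?_
    have hev : ∫ y, y i ∂Q = m' i := integral_eval.trans integral_id_gaussianReal
    rw [integral_sub (hlin i) (integrable_const _),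
      integral_const_mul, integral_sub (hcoord i) (integrable_const _), hev]
    simp
  have hvar : ((∫ y, T y ∂Q) - c) ^ 2 ≤ ∫ y, (T y - c) ^ 2 ∂Q := by
    have h := (even_two.convexOn_pow (𝕜 := ℝ)).map_integral_le (μ := Q)
      (continuous_pow 2).continuousOn isClosed_univ (by simp) (hc2.integrable (by simp))
      hc2.integrable_sq
    rwa [integral_sub (hL2.integrable (by simp)) (integrable_const _), integral_const,
      probReal_univ, one_smul] at h
  calc _ ≤ ENNReal.ofReal (Real.exp (∫ y, _ ∂Q)) := by
        refine ENNReal.ofReal_le_ofReal (Real.exp_le_exp.2 ?_)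
        rw [integral_add' hllr (hc2.integrable_sq.const_mul α), hmean, integral_const_mul]
        linarith [mul_le_mul_of_nonneg_left hvar hα]
    _ ≤ _ := ofReal_exp_integral_le_lintegral_exp hint
    _ = _ := lintegral_congr fun y => by
        rw [Pi.mul_apply, ← ENNReal.ofReal_mul (Real.exp_pos _).le, ← Real.exp_add, Pi.add_apply]

/-- Linear Gaussian model `P_θ = N(θ·s, v·Iₙ)`: for any unbiased square-integrable
estimator and any `α > ‖s‖²/(2v)`, the exponential moment `E_θ[exp(α(θ̂ − θ)²)]`
is infinite for every `θ` (so `α_c ≤ ‖s‖²/(2v)` for unbiased estimators). -/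
theorem stmt_17 (n : ℕ) (hn : 1 ≤ n) (s : Fin n → ℝ) (hs : s ≠ 0)
    (v : ℝ) (hv : 0 < v)
    (θhat : (Fin n → ℝ) → ℝ) (hmeas : Measurable θhat)
    (hsq : ∀ θ : ℝ, Integrable (fun y => (θhat y) ^ 2)
      (Measure.pi fun i => gaussianReal (θ * s i) (Real.toNNReal v)))
    (hunb : ∀ θ : ℝ,
      ∫ y, θhat y ∂(Measure.pi fun i => gaussianReal (θ * s i) (Real.toNNReal v)) = θ) :
    ∀ α : ℝ, (∑ i, (s i) ^ 2) / (2 * v) < α → ∀ θ : ℝ,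
      ∫⁻ y, ENNReal.ofReal (Real.exp (α * (θhat y - θ) ^ 2))
        ∂(Measure.pi fun i => gaussianReal (θ * s i) (Real.toNNReal v)) = ⊤ := by
  intro α hα θ
  set S : ℝ := ∑ i, s i ^ 2 with hS
  have hα0 : 0 ≤ α := le_trans (by positivity) hα.le
  have key : ∀ h : ℝ, ENNReal.ofReal (Real.exp ((α - S / (2 * v)) * h ^ 2)) ≤
      ∫⁻ y, ENNReal.ofReal (Real.exp (α * (θhat y - θ) ^ 2))
        ∂(Measure.pi fun i => gaussianReal (θ * s i) (Real.toNNReal v)) := by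
    intro h
    have hb := ofReal_exp_le_lintegral_exp_mul_sq hv (fun i => θ * s i) (fun i => (θ + h) * s i)
      hmeas (hsq (θ + h)) hα0 θ
    rw [hunb] at hb
    refine le_trans (ENNReal.ofReal_le_ofReal (Real.exp_le_exp.2 (le_of_eq ?_))) hb
    have : ∑ i, (θ * s i - (θ + h) * s i) ^ 2 = S * h ^ 2 := by
      rw [hS, Finset.sum_mul]
      exact Finset.sum_congr rfl fun i _ => by ring
    rw [this]
    ring
  have hlim : Filter.Tendsto
      (fun h : ℝ => ENNReal.ofReal (Real.exp ((α - S / (2 * v)) * h ^ 2))) Filter.atTop (nhds ⊤) :=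
    ENNReal.tendsto_ofReal_atTop.comp (Real.tendsto_exp_atTop.comp
      ((Filter.tendsto_pow_atTop two_ne_zero).const_mul_atTop (sub_pos.2 hα)))
  exact top_le_iff.1 (le_of_tendsto hlim (Filter.Eventually.of_forall key))
end
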